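/- Let φ(z) = (az+b)/(cz+d) (a,b,c,d ∈ ℂ, ad−bc ≠ 0) be a linear fractional self-map of 𝔻 having a fixed point on the unit circle ∂𝔻, let σ(z) = (conj(a)·z − conj(c))/(−conj(b)·z + conj(d)), let β ∈ ℂ \ {0}, let ψ(z) = β·K_{σ(0)}(z), let p ∈ 𝔻 \ {0}, and let λ ∈ ℂ with |λ| = 1 and λp = conj(p). If the weighted composition operator W_{ψ,φ} on H² is normal, then W_{ψ,φ} is JW_{ξ_p,τ_p}-normal if and only if a·conj(b) − c·conj(d) = conj(b)·d − conj(a)·c and (|a|² − |d|²)·|p|² = 2·Re((a·conj(c) − b·conj(d))·p). -/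

import Mathlib

open scoped ComplexConjugate InnerProductSpace ENNReal NNReal
open Complex Metric

noncomputable section

abbrev H2 : Type := lp (fun _ : ℕ => ℂ) 2

namespace H2

/-- Evaluation of an element of `H²` (given by its sequence of Taylor coefficients)
at a point `z` of the unit disk: `f(z) = ∑ aₙ zⁿ`. -/
def eval (f : H2) (z : ℂ) : ℂ := ∑' n : ℕ, (f : ∀ _ : ℕ, ℂ) n * z ^ n

/-- The Szegő kernel function `K_w(z) = 1/(1 - conj w * z)`. -/
def ker (w z : ℂ) : ℂ := (1 - conj w * z)⁻¹

lemma kernel_memℓp (w : ℂ) (hw : ‖w‖ < 1) :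
    Memℓp (fun n : ℕ => (conj w) ^ n) 2 := by
  apply memℓp_gen
  have hsum : Summable (fun n : ℕ => (‖w‖ ^ 2) ^ n) :=
    summable_geometric_of_lt_one (by positivity) (by nlinarith [norm_nonneg w])
  refine hsum.congr fun n => ?_
  have h2 : ((2 : ℝ≥0∞).toReal) = ((2 : ℕ) : ℝ) := by simp
  rw [h2, Real.rpow_natCast]
  simp [norm_pow, ← pow_mul, Nat.mul_comm]

/-- The reproducing kernel of `H²` at `w` in the unit disk, as an element of `H²`. -/
def kernel (w : ℂ) : H2 :=
  if hw : ‖w‖ < 1 then ⟨fun n : ℕ => (conj w) ^ n, kernel_memℓp w hw⟩ else 0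

/-- `T` is the composition operator `C_φ` on `H²`. -/
def IsCompOp (φ : ℂ → ℂ) (T : H2 →L[ℂ] H2) : Prop :=
  ∀ f : H2, ∀ z : ℂ, ‖z‖ < 1 → eval (T f) z = eval f (φ z)

/-- `W` is the weighted composition operator `W_{ψ,φ}` on `H²`. -/
def IsWCompOp (ψ φ : ℂ → ℂ) (W : H2 →L[ℂ] H2) : Prop :=
  ∀ f : H2, ∀ z : ℂ, ‖z‖ < 1 → eval (W f) z = ψ z * eval f (φ z)

/-- A conjugation on `H²`: a conjugate-linear involution satisfying `⟪Cx, Cy⟫ = ⟪y, x⟫`. -/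
structure IsConjugation (C : H2 → H2) : Prop where
  map_add : ∀ x y : H2, C (x + y) = C x + C y
  map_smul : ∀ (c : ℂ) (x : H2), C (c • x) = conj c • C x
  invol : ∀ x : H2, C (C x) = x
  inner_conj : ∀ x y : H2, ⟪C x, C y⟫_ℂ = ⟪y, x⟫_ℂ

/-- `T` is `C`-normal: `C T* T C = T T*`. -/
def CNormal (C : H2 → H2) (T : H2 →L[ℂ] H2) : Prop :=
  ∀ x : H2, C ((ContinuousLinearMap.adjoint T) (T (C x)))
      = T ((ContinuousLinearMap.adjoint T) x)

/-- `T` is a normal operator: `T* T = T T*`. -/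
def IsNormalOp (T : H2 →L[ℂ] H2) : Prop :=
  (ContinuousLinearMap.adjoint T).comp T = T.comp (ContinuousLinearMap.adjoint T)

/-- `T` is a unitary operator. -/
def IsUnitaryOp (T : H2 →L[ℂ] H2) : Prop :=
  T.comp (ContinuousLinearMap.adjoint T) = ContinuousLinearMap.id ℂ H2 ∧
  (ContinuousLinearMap.adjoint T).comp T = ContinuousLinearMap.id ℂ H2

/-- `C` is the conjugation `J_μ` on `H²`: `(J_μ f)(z) = conj (f (μ * conj z))`. -/
def IsJmu (μ : ℂ) (C : H2 → H2) : Prop :=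
  ∀ f : H2, ∀ z : ℂ, ‖z‖ < 1 → eval (C f) z = conj (eval f (μ * conj z))

/-- `ξ_p(z) = √(1-|p|²) / (1 - conj p * z)`. -/
def xi (p z : ℂ) : ℂ := (Real.sqrt (1 - ‖p‖ ^ 2) : ℂ) / (1 - conj p * z)

/-- `τ_p(z) = λ (p - z) / (1 - conj p * z)`. -/
def tau (p lam z : ℂ) : ℂ := lam * (p - z) / (1 - conj p * z)

/-- `C` is the conjugation `J W_{ξ_p, τ_p}` on `H²`:
`(C f)(z) = conj (ξ_p(conj z) * f (τ_p (conj z)))`. -/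
def IsJW (p lam : ℂ) (C : H2 → H2) : Prop :=
  ∀ f : H2, ∀ z : ℂ, ‖z‖ < 1 →
    eval (C f) z = conj (xi p (conj z) * eval f (tau p lam (conj z)))

end H2

namespace H2

lemma inner_kernel (f : H2) {w : ℂ} (hw : ‖w‖ < 1) : ⟪kernel w, f⟫_ℂ = eval f w := by
  rw [kernel, dif_pos hw, lp.inner_eq_tsum, eval]
  refine tsum_congr fun n => ?_
  simp [mul_comm]

lemma eval_smul (k : ℂ) (f : H2) {z : ℂ} (hz : ‖z‖ < 1) : eval (k • f) z = k * eval f z := by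
  simp only [← inner_kernel _ hz, inner_smul_right]

lemma norm_conj_mul_lt_one {w z : ℂ} (hw : ‖w‖ < 1) (hz : ‖z‖ < 1) : ‖conj w * z‖ < 1 := by
  rw [norm_mul, RCLike.norm_conj]
  exact mul_lt_one_of_nonneg_of_lt_one_left (norm_nonneg _) hw hz.le

lemma one_sub_conj_mul_ne_zero {w z : ℂ} (hw : ‖w‖ < 1) (hz : ‖z‖ < 1) :
    1 - conj w * z ≠ 0 := by
  intro h
  have h1 := norm_conj_mul_lt_one hw hz
  rw [← sub_eq_zero.mp h] at h1
  simp at h1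

lemma ker_div_div {n₁ d₁ n₂ d₂ : ℂ} (h₁ : d₁ ≠ 0) (h₂ : d₂ ≠ 0) :
    ker (n₂ / d₂) (n₁ / d₁) = d₁ * conj d₂ / (d₁ * conj d₂ - n₁ * conj n₂) := by
  have h₂' : conj d₂ ≠ 0 := (map_ne_zero _).mpr h₂
  rw [ker, map_div₀, inv_eq_one_div, eq_comm, ← div_div_div_cancel_right₀ (mul_ne_zero h₁ h₂'),
    div_self (mul_ne_zero h₁ h₂')]
  congr 1
  field_simp

lemma eval_kernel {w z : ℂ} (hw : ‖w‖ < 1) (hz : ‖z‖ < 1) : eval (kernel w) z = ker w z := by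
  rw [kernel, dif_pos hw, eval, ker, ← tsum_geometric_of_norm_lt_one (norm_conj_mul_lt_one hw hz)]
  exact tsum_congr fun n => (mul_pow _ _ _).symm

lemma hasFPowerSeriesAt_eval (f : H2) :
    HasFPowerSeriesAt (eval f) (FormalMultilinearSeries.ofScalars ℂ (f : ℕ → ℂ)) 0 := by
  have hr : (1 : ℝ≥0∞) ≤ (FormalMultilinearSeries.ofScalars ℂ (f : ℕ → ℂ)).radius := by
    rw [← ENNReal.coe_one]
    refine FormalMultilinearSeries.le_radius_of_bound _ ‖f‖ fun n => ?_
    rw [FormalMultilinearSeries.ofScalars_norm]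
    simpa using lp.norm_apply_le_norm two_ne_zero f n
  have h := FormalMultilinearSeries.hasFPowerSeriesOnBall _ (lt_of_lt_of_le one_pos hr)
  convert h.hasFPowerSeriesAt using 1
  ext z
  simp [eval, FormalMultilinearSeries.sum, mul_comm]

lemma ext_eval {f g : H2} (h : ∀ z : ℂ, ‖z‖ < 1 → eval f z = eval g z) : f = g := by
  have hev : ∀ᶠ z in nhds (0 : ℂ), eval f z = eval g z := by
    filter_upwards [ball_mem_nhds (0 : ℂ) one_pos] with z hz
    exact h z (by simpa using hz)
  have := HasFPowerSeriesAt.eq_formalMultilinearSeries_of_eventually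
    (hasFPowerSeriesAt_eval f) (hasFPowerSeriesAt_eval g) hev
  exact lp.ext (FormalMultilinearSeries.ofScalars_series_injective ℂ ℂ this)

lemma IsWCompOp.adjoint_kernel {ψ φ : ℂ → ℂ} {W : H2 →L[ℂ] H2} (hW : IsWCompOp ψ φ W)
    {w : ℂ} (hw : ‖w‖ < 1) (hφ : ‖φ w‖ < 1) :
    ContinuousLinearMap.adjoint W (kernel w) = conj (ψ w) • kernel (φ w) := by
  refine ext_inner_right ℂ fun f => ?_
  rw [ContinuousLinearMap.adjoint_inner_left, inner_kernel _ hw, hW f w hw, inner_smul_left,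
    inner_kernel _ hφ, conj_conj]

lemma IsWCompOp.eval_mul_adjoint_kernel {ψ φ : ℂ → ℂ} {W : H2 →L[ℂ] H2} (hW : IsWCompOp ψ φ W)
    {w z : ℂ} (hw : ‖w‖ < 1) (hz : ‖z‖ < 1) (hφw : ‖φ w‖ < 1) (hφz : ‖φ z‖ < 1) :
    eval (W (ContinuousLinearMap.adjoint W (kernel w))) z =
      ψ z * conj (ψ w) * ker (φ w) (φ z) := by
  rw [hW.adjoint_kernel hw hφw, map_smul, eval_smul _ _ hz, hW _ z hz, eval_kernel hφw hφz]
  ring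

lemma norm_tau_lt_one {p lam z : ℂ} (hp : ‖p‖ < 1) (hlam : ‖lam‖ = 1) (hz : ‖z‖ < 1) :
    ‖tau p lam z‖ < 1 := by
  have hd := one_sub_conj_mul_ne_zero hp hz
  rw [tau, norm_div, norm_mul, hlam, one_mul, div_lt_one (norm_pos_iff.mpr hd)]
  refine lt_of_pow_lt_pow_left₀ 2 (norm_nonneg _) ?_
  have h : ‖1 - conj p * z‖ ^ 2 - ‖p - z‖ ^ 2 = (1 - ‖p‖ ^ 2) * (1 - ‖z‖ ^ 2) := by
    simp only [← normSq_eq_norm_sq, normSq_apply, sub_re, sub_im, mul_re, mul_im, one_re, one_im,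
      conj_re, conj_im]
    ring
  have h1 : 0 < 1 - ‖p‖ ^ 2 := by nlinarith [norm_nonneg p]
  have h2 : 0 < 1 - ‖z‖ ^ 2 := by nlinarith [norm_nonneg z]
  nlinarith [mul_pos h1 h2]

lemma IsJW.apply_kernel {p lam : ℂ} {C : H2 → H2} (hC : IsJW p lam C) (hp : ‖p‖ < 1)
    (hlam : ‖lam‖ = 1) (hlp : lam * p = conj p) {w : ℂ} (hw : ‖w‖ < 1) :
    C (kernel w) = conj (xi p (conj w)) • kernel (tau p lam (conj w)) := by
  have hw' : ‖conj w‖ < 1 := by rwa [RCLike.norm_conj]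
  have htw := norm_tau_lt_one hp hlam hw'
  refine ext_eval fun z hz => ?_
  have hz' : ‖conj z‖ < 1 := by rwa [RCLike.norm_conj]
  have htz := norm_tau_lt_one hp hlam hz'
  rw [hC _ z hz, eval_kernel hw htz, eval_smul _ _ hz, eval_kernel htw hz]
  have hτ : ∀ u v : ℂ, ‖u‖ < 1 →
      xi p u * (1 - v * tau p lam u)⁻¹ =
        (Real.sqrt (1 - ‖p‖ ^ 2) : ℂ) / (1 - conj p * u - v * (lam * (p - u))) := by
    intro u v hu
    have hu' := one_sub_conj_mul_ne_zero hp hu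
    rw [xi, tau, ← div_eq_mul_inv, div_div, mul_sub, mul_one]
    congr 2
    field_simp
  have hker : ker (tau p lam (conj w)) z = conj (1 - conj z * tau p lam (conj w))⁻¹ := by
    simp [ker, mul_comm]
  rw [hker, ← map_mul, ker, hτ _ _ hz', hτ _ _ hw']
  congr 2
  linear_combination (conj z - conj w) * hlp

/-- A `JW`-normality criterion tested on reproducing kernels. -/
lemma cNormal_iff_of_isNormalOp {ψ φ : ℂ → ℂ} {W : H2 →L[ℂ] H2} (hW : IsWCompOp ψ φ W)
    (hself : ∀ z : ℂ, ‖z‖ < 1 → ‖φ z‖ < 1) (hnormal : IsNormalOp W)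
    {p lam : ℂ} (hp : ‖p‖ < 1) (hlam : ‖lam‖ = 1) (hlp : lam * p = conj p)
    {C : H2 → H2} (hC : IsConjugation C) (hCJ : IsJW p lam C) :
    CNormal C W ↔ ∀ z w : ℂ, ‖z‖ < 1 → ‖w‖ < 1 →
      conj (xi p (conj z) * (conj (xi p (conj w)) * (ψ (tau p lam (conj z)) *
        conj (ψ (tau p lam (conj w))) * ker (φ (tau p lam (conj w))) (φ (tau p lam (conj z)))))) =
      ψ z * conj (ψ w) * ker (φ w) (φ z) := by
  have hN : ∀ x, ContinuousLinearMap.adjoint W (W x) = W (ContinuousLinearMap.adjoint W x) :=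
    fun x => DFunLike.congr_fun hnormal x
  have hcn : ∀ {u : ℂ}, ‖u‖ < 1 → ‖conj u‖ < 1 := fun hu => by rwa [RCLike.norm_conj]
  have ht : ∀ {u : ℂ}, ‖u‖ < 1 → ‖tau p lam (conj u)‖ < 1 :=
    fun hu => norm_tau_lt_one hp hlam (hcn hu)
  have key : ∀ z w : ℂ, ‖z‖ < 1 → ‖w‖ < 1 →
      eval (C (ContinuousLinearMap.adjoint W (W (C (kernel w))))) z =
      conj (xi p (conj z) * (conj (xi p (conj w)) * (ψ (tau p lam (conj z)) *
        conj (ψ (tau p lam (conj w))) *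
          ker (φ (tau p lam (conj w))) (φ (tau p lam (conj z)))))) := by
    intro z w hz hw
    rw [hN, hCJ _ z hz, hCJ.apply_kernel hp hlam hlp hw, map_smul, map_smul, eval_smul _ _ (ht hz),
      hW.eval_mul_adjoint_kernel (ht hw) (ht hz) (hself _ (ht hw)) (hself _ (ht hz))]
  constructor
  · intro h z w hz hw
    rw [← key z w hz hw, h, hW.eval_mul_adjoint_kernel hw hz (hself _ hw) (hself _ hz)]
  · intro h x
    have hk : ∀ w : ℂ, ‖w‖ < 1 → C (ContinuousLinearMap.adjoint W (W (C (kernel w)))) =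
        W (ContinuousLinearMap.adjoint W (kernel w)) := by
      intro w hw
      refine ext_eval fun z hz => ?_
      rw [key z w hz hw, h z w hz hw,
        hW.eval_mul_adjoint_kernel hw hz (hself _ hw) (hself _ hz)]
    refine ext_eval fun z hz => ?_
    have hsymm : ∀ x y : H2, ⟪x, C y⟫_ℂ = ⟪y, C x⟫_ℂ := fun x y => by
      rw [← hC.inner_conj, hC.invol]
    rw [← inner_kernel _ hz, ← inner_kernel _ hz, hsymm,
      ContinuousLinearMap.adjoint_inner_left, ← ContinuousLinearMap.adjoint_inner_right,
      ← hC.inner_conj, hC.invol, hk z hz, ← ContinuousLinearMap.adjoint_inner_right,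
      ContinuousLinearMap.adjoint_inner_left]

/-- Normality tested on kernels, for an operator sending kernels to multiples of kernels. -/
lemma IsWCompOp.kernel_identity_of_isNormalOp {ψ φ σ k : ℂ → ℂ} {W : H2 →L[ℂ] H2}
    (hW : IsWCompOp ψ φ W) (hself : ∀ z : ℂ, ‖z‖ < 1 → ‖φ z‖ < 1) (hnormal : IsNormalOp W)
    (hσ : ∀ z : ℂ, ‖z‖ < 1 → ‖σ z‖ < 1)
    (hk : ∀ w : ℂ, ‖w‖ < 1 → W (kernel w) = k w • kernel (σ w))
    {z w : ℂ} (hz : ‖z‖ < 1) (hw : ‖w‖ < 1) :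
    conj (k z) * k w * ker (σ w) (σ z) = ψ z * conj (ψ w) * ker (φ w) (φ z) := by
  rw [← hW.eval_mul_adjoint_kernel hw hz (hself _ hw) (hself _ hz),
    ← show ContinuousLinearMap.adjoint W (W (kernel w)) = W (ContinuousLinearMap.adjoint W (kernel w))
      from DFunLike.congr_fun hnormal (kernel w),
    ← inner_kernel _ hz, ContinuousLinearMap.adjoint_inner_right, hk z hz, hk w hw,
    inner_smul_left, inner_smul_right, inner_kernel _ (hσ z hz), eval_kernel (hσ w hw) (hσ z hz)]
  ring

/-- The boundary case of the self-map condition for a linear fractional map. -/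
lemma norm_num_le_norm_den {a b c d : ℂ} (hden : ∀ z : ℂ, ‖z‖ < 1 → c * z + d ≠ 0)
    (hself : ∀ z : ℂ, ‖z‖ < 1 → ‖(a * z + b) / (c * z + d)‖ < 1) {z : ℂ} (hz : ‖z‖ ≤ 1) :
    ‖a * z + b‖ ≤ ‖c * z + d‖ := by
  have hcl : IsClosed {z : ℂ | ‖a * z + b‖ ≤ ‖c * z + d‖} :=
    isClosed_le (by fun_prop) (by fun_prop)
  have hsub : closure (ball (0 : ℂ) 1) ⊆ {z : ℂ | ‖a * z + b‖ ≤ ‖c * z + d‖} := by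
    refine hcl.closure_subset_iff.mpr fun u hu => ?_
    have hu' : ‖u‖ < 1 := by simpa using hu
    have := hself u hu'
    rw [norm_div, div_lt_one (norm_pos_iff.mpr (hden u hu'))] at this
    exact this.le
  rw [closure_ball _ one_ne_zero] at hsub
  exact hsub (by simpa using hz)

/-- The Cowen adjoint map of a linear fractional self-map of the disk is again a self-map. -/
lemma norm_cowen_adjoint_lt {a b c d : ℂ} (hdet : a * d - b * c ≠ 0)
    (hden : ∀ z : ℂ, ‖z‖ < 1 → c * z + d ≠ 0)
    (hself : ∀ z : ℂ, ‖z‖ < 1 → ‖(a * z + b) / (c * z + d)‖ < 1) {w : ℂ} (hw : ‖w‖ < 1) :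
    ‖c - a * w‖ < ‖d - b * w‖ := by
  by_contra! hle
  obtain ⟨z, hz, hroot⟩ : ∃ z : ℂ, ‖z‖ ≤ 1 ∧ c * z + d = w * (a * z + b) := by
    by_cases h0 : c - a * w = 0
    · have h1 : d - b * w = 0 := by simpa [h0] using hle
      exact ⟨0, by simp, by linear_combination h1⟩
    · refine ⟨-(d - b * w) / (c - a * w), ?_, ?_⟩
      · rw [norm_div, norm_neg, div_le_one (norm_pos_iff.mpr h0)]
        exact hle
      · have hcancel := div_mul_cancel₀ (-(d - b * w)) h0
        linear_combination hcancel
  have hle' := norm_num_le_norm_den hden hself hz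
  rw [hroot, norm_mul] at hle'
  have h1 : a * z + b = 0 := by
    rw [← norm_le_zero_iff]
    nlinarith [norm_nonneg (a * z + b)]
  have h2 : c * z + d = 0 := by rw [hroot, h1, mul_zero]
  exact hdet (by linear_combination a * h2 - c * h1)

end H2

/-- Let `φ` be a linear fractional self-map of `𝔻` with a fixed point on `∂𝔻`, and
`ψ = β K_{σ(0)}`. If `W_{ψ,φ}` is normal, then `W_{ψ,φ}` is `J W_{ξ_p,τ_p}`-normal iff
`a conj b - c conj d = conj b * d - conj a * c` and
`(|a|² - |d|²) |p|² = 2 Re((a conj c - b conj d) p)`. -/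
theorem stmt13 (a b c d β p lam : ℂ) (hβ : β ≠ 0)
    (hp : ‖p‖ < 1) (hp0 : p ≠ 0) (hlam : ‖lam‖ = 1) (hlp : lam * p = conj p)
    (φ : ℂ → ℂ) (hφ : ∀ z : ℂ, φ z = (a * z + b) / (c * z + d))
    (hdet : a * d - b * c ≠ 0)
    (hden : ∀ z : ℂ, ‖z‖ < 1 → c * z + d ≠ 0)
    (hself : ∀ z : ℂ, ‖z‖ < 1 → ‖φ z‖ < 1)
    (hfix : ∃ ζ : ℂ, ‖ζ‖ = 1 ∧ (a * ζ + b) / (c * ζ + d) = ζ)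
    (σ : ℂ → ℂ) (hσ : ∀ z : ℂ, σ z = (conj a * z - conj c) / (-(conj b) * z + conj d))
    (ψ : ℂ → ℂ) (hψ : ∀ z : ℂ, ψ z = β * H2.ker (σ 0) z)
    (W : H2 →L[ℂ] H2) (hW : H2.IsWCompOp ψ φ W)
    (hnormal : H2.IsNormalOp W)
    (C : H2 → H2) (hC : H2.IsConjugation C) (hCJ : H2.IsJW p lam C) :
    H2.CNormal C W ↔
      (a * conj b - c * conj d = conj b * d - conj a * c ∧
        (‖a‖ ^ 2 - ‖d‖ ^ 2) * ‖p‖ ^ 2 = 2 * ((a * conj c - b * conj d) * p).re) := by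
  have hd : d ≠ 0 := by simpa using hden 0 (by simp)
  have hβd : β * d ≠ 0 := mul_ne_zero hβ hd
  have hcd : conj d ≠ 0 := (map_ne_zero _).mpr hd
  have hcn : ∀ {u : ℂ}, ‖u‖ < 1 → ‖conj u‖ < 1 := fun hu => by rwa [RCLike.norm_conj]
  have hself' : ∀ z : ℂ, ‖z‖ < 1 → ‖(a * z + b) / (c * z + d)‖ < 1 :=
    fun z hz => hφ z ▸ hself z hz
  have hψ' : ∀ z : ℂ, ‖z‖ < 1 → ψ z = β * d / (c * z + d) := by
    intro z hz
    have hσ0 : σ 0 = -conj c / conj d := by simp [hσ]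
    have := H2.ker_div_div (n₁ := z) (d₁ := 1) (n₂ := -conj c) one_ne_zero hcd
    rw [div_one] at this
    rw [hψ, hσ0, this]
    simp only [map_neg, conj_conj]
    ring
  set D : ℂ → ℂ → ℂ := fun z w =>
    (c * z + d) * conj (c * w + d) - (a * z + b) * conj (a * w + b) with hD
  have hN : ∀ z w : ℂ, ‖z‖ < 1 → ‖w‖ < 1 →
      ψ z * conj (ψ w) * H2.ker (φ w) (φ z) = β * d * conj (β * d) / D z w := by
    intro z w hz hw
    have h1 := hden z hz
    have h2 : conj (c * w + d) ≠ 0 := (map_ne_zero _).mpr (hden w hw)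
    rw [hψ' z hz, hψ' w hw, hφ, hφ, H2.ker_div_div (hden z hz) (hden w hw), map_div₀]
    simp only [hD]
    rw [div_mul_div_comm, div_mul_div_comm, mul_comm (β * d * conj (β * d)),
      mul_div_mul_left _ _ (mul_ne_zero h1 h2)]
  have hDne : ∀ z w : ℂ, ‖z‖ < 1 → ‖w‖ < 1 → D z w ≠ 0 := by
    intro z w hz hw h0
    have h1 := H2.one_sub_conj_mul_ne_zero (hself w hw) (hself z hz)
    have h3 := H2.ker_div_div (n₁ := a * z + b) (n₂ := a * w + b) (hden z hz) (hden w hw)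
    rw [← hφ, ← hφ, show (c * z + d) * conj (c * w + d) - (a * z + b) * conj (a * w + b) = 0 from h0,
      div_zero, H2.ker] at h3
    exact h1 (inv_eq_zero.mp h3)
  have hσden : ∀ w : ℂ, ‖w‖ < 1 → ‖c - a * conj w‖ < ‖d - b * conj w‖ :=
    fun w hw => H2.norm_cowen_adjoint_lt hdet hden hself' (hcn hw)
  have hden' : ∀ w : ℂ, ‖w‖ < 1 → d - b * conj w ≠ 0 := fun w hw =>
    norm_pos_iff.mp ((norm_nonneg _).trans_lt (hσden w hw))
  have hσ' : ∀ w : ℂ, σ w = -conj (c - a * conj w) / conj (d - b * conj w) := by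
    intro w
    rw [hσ]
    simp only [map_sub, map_mul, conj_conj]
    ring_nf
  have hσ1 : ∀ w : ℂ, ‖w‖ < 1 → ‖σ w‖ < 1 := by
    intro w hw
    rw [hσ', norm_div, norm_neg, RCLike.norm_conj, RCLike.norm_conj,
      div_lt_one (norm_pos_iff.mpr (hden' w hw))]
    exact hσden w hw
  have hWk : ∀ w : ℂ, ‖w‖ < 1 →
      W (H2.kernel w) = (β * d / (d - b * conj w)) • H2.kernel (σ w) := by
    intro w hw
    refine H2.ext_eval fun z hz => ?_
    rw [hW _ z hz, H2.eval_smul _ _ hz, H2.eval_kernel hw (hself z hz),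
      H2.eval_kernel (hσ1 w hw) hz, hψ' z hz, hφ]
    have h1 := H2.ker_div_div (n₁ := a * z + b) (n₂ := w) (hden z hz) one_ne_zero
    have h2 := H2.ker_div_div (n₁ := z) (n₂ := -conj (c - a * conj w)) one_ne_zero
      ((map_ne_zero conj).mpr (hden' w hw))
    rw [div_one] at h1 h2
    rw [h1, hσ', h2]
    simp only [map_one, mul_one, one_mul, map_neg, conj_conj]
    rw [div_mul_div_cancel₀ (hden z hz), div_mul_div_cancel₀ (hden' w hw)]
    congr 1
    ring
  have hD' : ∀ z w : ℂ, ‖z‖ < 1 → ‖w‖ < 1 → D z w =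
      (d - b * conj w) * conj (d - b * conj z) - (c - a * conj w) * conj (c - a * conj z) := by
    intro z w hz hw
    have h := hW.kernel_identity_of_isNormalOp hself hnormal hσ1 hWk hz hw
    have h1 := hden' w hw
    have h2 : conj (d - b * conj z) ≠ 0 := (map_ne_zero _).mpr (hden' z hz)
    rw [hN z w hz hw, hσ', hσ', H2.ker_div_div h2 ((map_ne_zero conj).mpr h1), map_div₀,
      conj_conj, div_mul_div_comm, div_mul_div_comm, map_neg, conj_conj, mul_comm (conj (β * d)),
      mul_comm (β * d * conj (β * d)), mul_div_mul_left _ _ (mul_ne_zero h2 h1)] at h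
    have hk : β * d * conj (β * d) ≠ 0 := mul_ne_zero hβd ((map_ne_zero _).mpr hβd)
    rw [div_eq_mul_inv, div_eq_mul_inv] at h
    rw [← inv_injective (mul_left_cancel₀ hk h)]
    ring
  have hbc : b * conj b = c * conj c := by
    simpa [hD] using hD' 0 0 (by simp) (by simp)
  have hB : a * conj b - c * conj d = conj b * d - conj a * c := by
    have := hD' (1 / 2) 0 (by norm_num) (by simp)
    simp [hD] at this
    linear_combination (-2) * this - 2 * hbc
  have hB' : conj a * b - conj c * d = b * conj d - a * conj c := by
    simpa using congrArg conj hB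
  have hpp : p * conj p = (‖p‖ : ℂ) ^ 2 := mul_conj' p
  have hreal : (‖a‖ ^ 2 - ‖d‖ ^ 2) * ‖p‖ ^ 2 = 2 * ((a * conj c - b * conj d) * p).re ↔
      (a * conj a - d * conj d) * (p * conj p) =
        (a * conj c - b * conj d) * p + (conj a * c - conj b * d) * conj p := by
    have h := add_conj ((a * conj c - b * conj d) * p)
    simp only [map_mul, map_sub, conj_conj] at h
    rw [h, mul_conj', mul_conj', mul_conj']
    norm_cast
  rw [and_iff_right hB, hreal, H2.cNormal_iff_of_isNormalOp hW hself hnormal hp hlam hlp hC hCJ]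
  have hll : lam * conj lam = 1 := by rw [mul_conj', hlam]; simp
  have hlp' : conj lam * conj p = p := by simpa using congrArg conj hlp
  have hsq : (Real.sqrt (1 - ‖p‖ ^ 2) : ℂ) * (Real.sqrt (1 - ‖p‖ ^ 2) : ℂ) = 1 - p * conj p := by
    rw [← ofReal_mul, Real.mul_self_sqrt (by nlinarith [norm_nonneg p]), hpp]
    norm_cast
  have key : ∀ z w : ℂ, ‖z‖ < 1 → ‖w‖ < 1 →
      (conj (H2.xi p (conj z) * (conj (H2.xi p (conj w)) * (ψ (H2.tau p lam (conj z)) *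
        conj (ψ (H2.tau p lam (conj w))) *
          H2.ker (φ (H2.tau p lam (conj w))) (φ (H2.tau p lam (conj z)))))) =
        ψ z * conj (ψ w) * H2.ker (φ w) (φ z) ↔
      (1 - p * conj p) * D z w =
        (conj c * (p - conj lam * z) + conj d * (1 - p * z)) *
          (c * (conj p - lam * conj w) + d * (1 - conj p * conj w)) -
        (conj a * (p - conj lam * z) + conj b * (1 - p * z)) *
          (a * (conj p - lam * conj w) + b * (1 - conj p * conj w))) := by
    intro z w hz hw
    have htz := H2.norm_tau_lt_one hp hlam (hcn hz)
    have htw := H2.norm_tau_lt_one hp hlam (hcn hw)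
    rw [hN z w hz hw, hN _ _ htz htw]
    have hDt := hDne _ _ htz htw
    have hz1 := H2.one_sub_conj_mul_ne_zero hp (hcn hz)
    have hw1 := H2.one_sub_conj_mul_ne_zero hp (hcn hw)
    have htz1 : conj (1 - conj p * conj z) * conj (H2.tau p lam (conj z)) = p - conj lam * z := by
      rw [← map_mul, H2.tau, mul_div_cancel₀ _ hz1]
      simp only [map_mul, map_sub, conj_conj]
      linear_combination hlp'
    have htw1 : (1 - conj p * conj w) * H2.tau p lam (conj w) = conj p - lam * conj w := by
      rw [H2.tau, mul_div_cancel₀ _ hw1]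
      linear_combination hlp
    have hU : conj (1 - conj p * conj z) = 1 - p * z := by simp
    have hR : conj ((1 - conj p * conj z) * conj (1 - conj p * conj w) *
          D (H2.tau p lam (conj z)) (H2.tau p lam (conj w))) =
        (conj c * (p - conj lam * z) + conj d * (1 - p * z)) *
          (c * (conj p - lam * conj w) + d * (1 - conj p * conj w)) -
        (conj a * (p - conj lam * z) + conj b * (1 - p * z)) *
          (a * (conj p - lam * conj w) + b * (1 - conj p * conj w)) := by
      rw [← htz1, ← htw1, ← hU]
      simp only [hD, map_sub, map_mul, map_add, map_one, conj_conj]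
      ring
    have hk : β * d * conj (β * d) ≠ 0 := mul_ne_zero hβd ((map_ne_zero _).mpr hβd)
    have hw1' : conj (1 - conj p * conj w) ≠ 0 := (map_ne_zero _).mpr hw1
    have hξ : H2.xi p (conj z) * (conj (H2.xi p (conj w)) * (β * d * conj (β * d) /
          D (H2.tau p lam (conj z)) (H2.tau p lam (conj w)))) =
        (1 - p * conj p) * (β * d * conj (β * d)) / ((1 - conj p * conj z) *
          conj (1 - conj p * conj w) * D (H2.tau p lam (conj z)) (H2.tau p lam (conj w))) := by
      rw [H2.xi, H2.xi, map_div₀, conj_ofReal, div_mul_div_comm, div_mul_div_comm, ← hsq]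
      ring
    have hne := mul_ne_zero (mul_ne_zero hz1 hw1') hDt
    have hconj : conj ((1 - p * conj p) * (β * d * conj (β * d))) =
        (1 - p * conj p) * (β * d * conj (β * d)) := by
      simp only [map_mul, map_sub, map_one, conj_conj]
      ring
    rw [hξ, map_div₀, hconj, div_eq_div_iff ((map_ne_zero _).mpr hne) (hDne z w hz hw), hR,
      mul_right_comm, mul_comm (β * d * conj (β * d)) (_ - _), mul_left_inj' hk]
  constructor
  · intro h
    have h0 := (key 0 0 (by simp) (by simp)).mp (h 0 0 (by simp) (by simp))
    simp [hD] at h0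
    linear_combination h0 - p * conj p * hbc - p * hB' - conj p * hB
  · intro h z w hz hw
    rw [key z w hz hw]
    have hz1 : c * conj d - a * conj b + (d * conj c - b * conj a) * conj lam =
        -p * (d * conj d - a * conj a) := by
      refine mul_left_cancel₀ ((map_ne_zero conj).mpr hp0) ?_
      linear_combination (d * conj c - b * conj a) * hlp' - h - p * hB' - conj p * hB
    have hw1 : conj c * d - conj a * b + (conj d * c - conj b * a) * lam =
        -conj p * (conj d * d - conj a * a) := by
      simpa using congrArg conj hz1
    simp only [hD, map_add, map_mul]
    linear_combination (1 + z * conj w) * (h + p * conj p * hbc + p * hB' + conj p * hB) +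
      z * (hz1 - p * hbc + (c * conj c - a * conj a) * hlp') +
      conj w * (hw1 - conj p * hbc + (c * conj c - a * conj a) * hlp) -
      z * conj w * ((c * conj c - a * conj a) * hll + (conj c * d - conj a * b) * hlp' +
        (c * conj d - a * conj b) * hlp)
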